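/- Define P_n(x) = ∑_{k=0}^{n} (-1)^k · C(n,k) · C(n+k,k) · ((1-x)/2)^k for natural numbers n and real x. Then for every natural number n and every real number x, (n+2) · P_{n+2}(x) - (2n+3) · x · P_{n+1}(x) + (n+1) · P_n(x) = 0 (the three-term recurrence of the Legendre polynomials). -/

import Mathlib

/-- The Legendre polynomial `P_n(x) = ∑_{k=0}^{n} (-1)^k C(n,k) C(n+k,k) ((1-x)/2)^k`. -/
noncomputable def legendreP (n : ℕ) (x : ℝ) : ℝ :=
  ∑ k ∈ Finset.range (n + 1),
    (-1 : ℝ) ^ k * (n.choose k : ℝ) * ((n + k).choose k : ℝ) * ((1 - x) / 2) ^ k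

theorem cast_choose_succ_right_mul (n k : ℕ) :
    (n.choose (k + 1) : ℝ) * (k + 1) = n.choose k * (n - k) := by
  rcases le_or_gt k n with h | h
  · have := Nat.choose_succ_right_eq n k
    rw [← Nat.cast_sub h]
    exact_mod_cast this
  · simp [Nat.choose_eq_zero_of_lt h, Nat.choose_eq_zero_of_lt (Nat.lt_succ_of_lt h)]

theorem cast_choose_mul_succ (n k : ℕ) :
    (n.choose k : ℝ) * (n + 1) = (n + 1).choose k * (n + 1 - k) := by
  rcases le_or_gt k (n + 1) with h | h
  · have := Nat.choose_mul_succ_eq n k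
    have e : ((n + 1 - k : ℕ) : ℝ) = n + 1 - k := by rw [Nat.cast_sub h]; push_cast; rfl
    rw [← e]
    exact_mod_cast this
  · simp [Nat.choose_eq_zero_of_lt h, Nat.choose_eq_zero_of_lt (Nat.lt_of_succ_lt h)]

/-- The absolute value of the coefficient of `((1 - x) / 2) ^ k` in the `n`-th Legendre
polynomial. -/
noncomputable def legendreCoeff (n k : ℕ) : ℝ := (n.choose k : ℝ) * ((n + k).choose k : ℝ)

theorem legendreCoeff_zero_right (n : ℕ) : legendreCoeff n 0 = 1 := by simp [legendreCoeff]

theorem legendreCoeff_eq_zero {n k : ℕ} (h : n < k) : legendreCoeff n k = 0 := by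
  simp [legendreCoeff, Nat.choose_eq_zero_of_lt h]

theorem legendreCoeff_succ_right (n k : ℕ) :
    ((k : ℝ) + 1) ^ 2 * legendreCoeff n (k + 1) = (n - k) * (n + k + 1) * legendreCoeff n k := by
  have h₁ := cast_choose_succ_right_mul n k
  have h₂ : ((n : ℝ) + k + 1) * (n + k).choose k = (n + (k + 1)).choose (k + 1) * (k + 1) := by
    exact_mod_cast Nat.add_one_mul_choose_eq (n + k) k
  unfold legendreCoeff
  linear_combination ((n + (k + 1)).choose (k + 1) : ℝ) * (k + 1) * h₁ -
    (n.choose k : ℝ) * (n - k) * h₂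

theorem legendreCoeff_succ_left (n k : ℕ) :
    ((n : ℝ) + 1 - k) * legendreCoeff (n + 1) k = (n + 1 + k) * legendreCoeff n k := by
  have h₁ := cast_choose_mul_succ n k
  have h₂ := cast_choose_mul_succ (n + k) k
  rw [Nat.add_right_comm] at h₂
  push_cast at h₂
  unfold legendreCoeff
  apply mul_left_cancel₀ (Nat.cast_add_one_ne_zero n : (n : ℝ) + 1 ≠ 0)
  linear_combination -((n + 1 + k).choose k : ℝ) * (n + 1) * h₁ -
    (n.choose k : ℝ) * (n + 1) * h₂

theorem legendreCoeff_recurrence (n k : ℕ) :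
    ((n : ℝ) + 2) * legendreCoeff (n + 2) (k + 1) -
      (2 * n + 3) * (legendreCoeff (n + 1) (k + 1) + 2 * legendreCoeff (n + 1) k) +
      (n + 1) * legendreCoeff n (k + 1) = 0 := by
  have h₀ := legendreCoeff_succ_right n k
  have h₁ := legendreCoeff_succ_right (n + 1) k
  have h₂ := legendreCoeff_succ_right (n + 2) k
  have l₀ := legendreCoeff_succ_left n k
  have l₁ := legendreCoeff_succ_left (n + 1) k
  push_cast at h₁ h₂ l₁
  apply mul_left_cancel₀ (pow_ne_zero 2 (Nat.cast_add_one_ne_zero k) : ((k : ℝ) + 1) ^ 2 ≠ 0)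
  linear_combination ((n : ℝ) + 2) * h₂ - (2 * n + 3) * h₁ + (n + 1) * h₀ +
    ((n : ℝ) + 2) * (n + k + 3) * l₁ - ((n : ℝ) + 1) * (n - k) * l₀

theorem legendreP_eq_sum_range {n N : ℕ} (h : n < N) (x : ℝ) :
    legendreP n x = ∑ k ∈ Finset.range N, legendreCoeff n k * ((x - 1) / 2) ^ k := by
  have hterm (k : ℕ) : (-1 : ℝ) ^ k * (n.choose k : ℝ) * ((n + k).choose k : ℝ) *
      ((1 - x) / 2) ^ k = legendreCoeff n k * ((x - 1) / 2) ^ k := by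
    rw [show (x - 1) / 2 = -1 * ((1 - x) / 2) by ring, mul_pow, legendreCoeff]
    ring
  simp only [legendreP, hterm]
  refine Finset.sum_subset (Finset.range_subset_range.2 h) fun k _ hk => ?_
  rw [legendreCoeff_eq_zero (by simpa using hk), zero_mul]

/-- The three-term recurrence of the Legendre polynomials:
`(n+2)P_{n+2}(x) - (2n+3)xP_{n+1}(x) + (n+1)P_n(x) = 0`. -/
theorem legendre_recurrence (n : ℕ) (x : ℝ) :
    ((n : ℝ) + 2) * legendreP (n + 2) x - (2 * (n : ℝ) + 3) * x * legendreP (n + 1) x +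
      ((n : ℝ) + 1) * legendreP n x = 0 := by
  have hP₂ := legendreP_eq_sum_range (n := n + 2) (N := n + 3) (by omega) x
  have hP₁ := legendreP_eq_sum_range (n := n + 1) (N := n + 3) (by omega) x
  have hP₁' := legendreP_eq_sum_range (n := n + 1) (N := n + 2) (by omega) x
  have hP₀ := legendreP_eq_sum_range (n := n) (N := n + 3) (by omega) x
  rw [Finset.sum_range_succ', legendreCoeff_zero_right] at hP₂ hP₁ hP₀
  have hsum : ∑ k ∈ Finset.range (n + 2), (((n : ℝ) + 2) * legendreCoeff (n + 2) (k + 1) -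
      (2 * n + 3) * (legendreCoeff (n + 1) (k + 1) + 2 * legendreCoeff (n + 1) k) +
      (n + 1) * legendreCoeff n (k + 1)) * ((x - 1) / 2) ^ (k + 1) = 0 :=
    Finset.sum_eq_zero fun k _ => by rw [legendreCoeff_recurrence, zero_mul]
  have hsplit (k : ℕ) : (((n : ℝ) + 2) * legendreCoeff (n + 2) (k + 1) -
      (2 * n + 3) * (legendreCoeff (n + 1) (k + 1) + 2 * legendreCoeff (n + 1) k) +
      (n + 1) * legendreCoeff n (k + 1)) * ((x - 1) / 2) ^ (k + 1) =
      ((n : ℝ) + 2) * (legendreCoeff (n + 2) (k + 1) * ((x - 1) / 2) ^ (k + 1)) -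
      (2 * n + 3) * (legendreCoeff (n + 1) (k + 1) * ((x - 1) / 2) ^ (k + 1)) -
      (2 * n + 3) * (x - 1) * (legendreCoeff (n + 1) k * ((x - 1) / 2) ^ k) +
      (n + 1) * (legendreCoeff n (k + 1) * ((x - 1) / 2) ^ (k + 1)) := by ring
  simp only [hsplit, Finset.sum_add_distrib, Finset.sum_sub_distrib, ← Finset.mul_sum] at hsum
  linear_combination hsum + ((n : ℝ) + 2) * hP₂ - (2 * n + 3) * hP₁ -
    (2 * n + 3) * (x - 1) * hP₁' + ((n : ℝ) + 1) * hP₀
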